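/- Let Γ be a connected metric graph of first Betti number b ≥ 2 and total length L. Let n ∈ {1,...,b}. Then there exist at least n homologically independent loops in Γ based at the same point, each of length at most 24(log(b) + n) · L / b. -/

import Mathlib

/-- A metric graph: a finite graph (multiple edges and loops allowed) with a
nonnegative length assigned to each edge. -/
structure MGraph where
  V : Type
  E : Type
  fV : Fintype V
  fE : Fintype E
  deV : DecidableEq V
  deE : DecidableEq E
  s : E → V
  t : E → V
  len : E → ℝ
  len_nonneg : ∀ e, 0 ≤ len e

attribute [instance] MGraph.fV MGraph.fE MGraph.deV MGraph.deE

namespace MGraph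

variable (G : MGraph)

/-- The total length (one-dimensional Hausdorff measure) of the metric graph. -/
def totalLength : ℝ := ∑ e, G.len e

/-- A dart is an edge together with an orientation. -/
def dstart (d : G.E × Bool) : G.V := if d.2 then G.s d.1 else G.t d.1

def dend (d : G.E × Bool) : G.V := if d.2 then G.t d.1 else G.s d.1

/-- `G.IsWalk u v l` : the list of darts `l` is a walk from `u` to `v`. -/
def IsWalk : G.V → G.V → List (G.E × Bool) → Prop
  | u, v, [] => u = v
  | u, v, d :: l => G.dstart d = u ∧ IsWalk (G.dend d) v l

/-- The length of a walk. -/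
def walkLen (l : List (G.E × Bool)) : ℝ := (l.map fun d => G.len d.1).sum

/-- The real cycle vector of a closed walk: its class in `H₁(Γ, ℝ) ⊆ ℝ^E`, recording
the signed number of times each edge is traversed. A family of loops is homologically
independent iff their cycle vectors are linearly independent. -/
def cycVec (l : List (G.E × Bool)) : G.E → ℝ := fun e =>
  (l.map fun d => if d.1 = e then (if d.2 then (1 : ℝ) else -1) else 0).sum

/-- The graph is connected. -/
def Connected : Prop := ∀ u v : G.V, ∃ l, G.IsWalk u v l

/-- `G.bettiEq b` : the first Betti number `e - v + 1` of the connected graph `G`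
equals `b`. -/
def bettiEq (b : ℕ) : Prop :=
  (Fintype.card G.E : ℤ) - (Fintype.card G.V : ℤ) + 1 = (b : ℤ)

/-- The path distance between two vertices. -/
noncomputable def vdist (u v : G.V) : ℝ :=
  sInf {x | ∃ l, G.IsWalk u v l ∧ G.walkLen l = x}

/-- The list of vertices visited by a walk. -/
def walkVerts (l : List (G.E × Bool)) : List G.V := l.map G.dstart

/-- The distance from a vertex to a (nonempty) walk. -/
noncomputable def distToWalk (x : G.V) (l : List (G.E × Bool)) : ℝ :=
  sInf {d | ∃ v ∈ G.walkVerts l, G.vdist x v = d}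

/-- The distance between two loops. -/
noncomputable def loopDist (l₁ l₂ : List (G.E × Bool)) : ℝ :=
  sInf {d | ∃ u ∈ G.walkVerts l₁, ∃ v ∈ G.walkVerts l₂, G.vdist u v = d}

/-- A simple loop (embedded circle): a nonempty closed walk repeating no edge and
no vertex. -/
def IsSimpleLoop (l : List (G.E × Bool)) : Prop :=
  l ≠ [] ∧ (∃ v, G.IsWalk v v l) ∧ (l.map Prod.fst).Nodup ∧ (G.walkVerts l).Nodup

end MGraph

namespace MGraph

/-! ### Basic facts on walks -/

variable {G : MGraph}

theorem IsWalk.append {u v w : G.V} {l₁ l₂ : List (G.E × Bool)}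
    (h₁ : G.IsWalk u v l₁) (h₂ : G.IsWalk v w l₂) : G.IsWalk u w (l₁ ++ l₂) := by
  induction l₁ generalizing u with
  | nil => simp only [IsWalk] at h₁; subst h₁; simpa using h₂
  | cons d l ih => exact ⟨h₁.1, ih h₁.2⟩

/-- The reversal of a walk. -/
def rev (l : List (G.E × Bool)) : List (G.E × Bool) := (l.map fun d => (d.1, !d.2)).reverse

theorem IsWalk.rev {u v : G.V} {l : List (G.E × Bool)}
    (h : G.IsWalk u v l) : G.IsWalk v u (rev l) := by
  induction l generalizing u with
  | nil => simp only [IsWalk] at h; subst h; simp [MGraph.rev, IsWalk]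
  | cons d l ih =>
    have h2 := ih h.2
    have h1 := h.1
    have h3 : G.IsWalk (G.dend d) u [(d.1, !d.2)] := by
      refine ⟨?_, ?_⟩
      · cases hd : d.2 <;> simp [dstart, dend, hd]
      · rw [← h1]
        cases hd : d.2 <;> simp [IsWalk, dstart, dend, hd]
    have := h2.append h3
    simpa [MGraph.rev] using this

theorem walkLen_append (l₁ l₂ : List (G.E × Bool)) :
    G.walkLen (l₁ ++ l₂) = G.walkLen l₁ + G.walkLen l₂ := by
  simp [walkLen]

theorem walkLen_rev (l : List (G.E × Bool)) : G.walkLen (rev l) = G.walkLen l := by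
  simp [walkLen, rev, List.sum_reverse, Function.comp_def]

theorem walkLen_nonneg (l : List (G.E × Bool)) : 0 ≤ G.walkLen l := by
  unfold walkLen
  apply List.sum_nonneg
  intro x hx
  simp only [List.mem_map] at hx
  obtain ⟨d, -, rfl⟩ := hx
  exact G.len_nonneg _

theorem cycVec_append (l₁ l₂ : List (G.E × Bool)) :
    G.cycVec (l₁ ++ l₂) = G.cycVec l₁ + G.cycVec l₂ := by
  ext e; simp [cycVec]

theorem cycVec_rev (l : List (G.E × Bool)) : G.cycVec (rev l) = - G.cycVec l := by
  induction l with
  | nil => ext e; simp [cycVec, rev]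
  | cons d l ih =>
    have : rev (d :: l) = rev l ++ [(d.1, !d.2)] := by simp [rev]
    rw [this, cycVec_append, ih]
    ext e
    simp only [cycVec, Pi.add_apply, Pi.neg_apply, List.map_cons, List.sum_cons, List.map_nil,
      List.sum_nil]
    cases d.2 <;> by_cases h : d.1 = e <;> simp [h]

/-- The loop through the edge `e` given by chosen walks from the base point. -/
def eloop (p : G.V → List (G.E × Bool)) (e : G.E) : List (G.E × Bool) :=
  p (G.s e) ++ ([(e, true)] ++ rev (p (G.t e)))

theorem eloop_isWalk {x : G.V} {p : G.V → List (G.E × Bool)} (hp : ∀ v, G.IsWalk x v (p v))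
    (e : G.E) : G.IsWalk x x (eloop p e) := by
  refine (hp _).append (IsWalk.append (v := G.t e) ?_ (hp _).rev)
  exact ⟨by simp [dstart], by simp [dend, IsWalk]⟩

theorem walkLen_eloop (p : G.V → List (G.E × Bool)) (e : G.E) :
    G.walkLen (eloop p e) = G.walkLen (p (G.s e)) + G.len e + G.walkLen (p (G.t e)) := by
  rw [eloop, walkLen_append, walkLen_append, walkLen_rev]
  simp [walkLen, add_assoc]

theorem cycVec_eloop (p : G.V → List (G.E × Bool)) (e : G.E) :
    G.cycVec (eloop p e) =
      G.cycVec (p (G.s e)) + Pi.single e 1 - G.cycVec (p (G.t e)) := by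
  rw [eloop, cycVec_append, cycVec_append, cycVec_rev]
  have : G.cycVec [(e, true)] = Pi.single e 1 := by
    ext e'
    by_cases h : e = e'
    · subst h; simp [cycVec]
    · rw [Pi.single_apply, if_neg (Ne.symm h)]; simp [cycVec, h]
  rw [this]; abel

theorem exists_indep (x : G.V) (S : Finset G.V) (hx : x ∈ S) (F : Finset G.E)
    (hF : ∀ e ∈ F, G.s e ∈ S ∧ G.t e ∈ S) (p : G.V → List (G.E × Bool)) (hpx : p x = [])
    (n : ℕ) (hn : S.card + n ≤ F.card + 1) :
    ∃ c : Fin n → G.E, (∀ i, c i ∈ F) ∧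
      LinearIndependent ℝ (fun i => G.cycVec (eloop p (c i))) := by
  classical
  let v : F → (G.E → ℝ) := fun e => G.cycVec (eloop p e.1)
  let Φ : (F → ℝ) →ₗ[ℝ] (G.E → ℝ) := Fintype.linearCombination ℝ v
  let D : (F → ℝ) →ₗ[ℝ] (S.erase x → ℝ) :=
    { toFun := fun f w => ∑ e : F, f e * ((if G.s e.1 = w.1 then 1 else 0) -
        (if G.t e.1 = w.1 then 1 else 0))
      map_add' := by
        intro f g; ext w; simp [add_mul, Finset.sum_add_distrib]
      map_smul' := by
        intro r f; ext w; simp [mul_assoc, Finset.mul_sum] }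
  have hinj : Function.Injective (D.comp (LinearMap.ker Φ).subtype) := by
    rw [← LinearMap.ker_eq_bot, LinearMap.ker_eq_bot']
    rintro ⟨f, hf⟩ hD
    have hD' : ∀ w ∈ S, w ≠ x → ∑ e : F, f e * ((if G.s e.1 = w then (1:ℝ) else 0) -
        (if G.t e.1 = w then 1 else 0)) = 0 := by
      intro w hw hwx
      have := congrFun hD ⟨w, Finset.mem_erase.2 ⟨hwx, hw⟩⟩
      simpa [D] using this
    have hPx : G.cycVec (p x) = 0 := by rw [hpx]; ext; simp [cycVec]
    have hf' : ∑ e : F, f e • v e = 0 := by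
      have : Φ f = 0 := hf
      simpa [Φ, Fintype.linearCombination_apply] using this
    have key : ∑ e : F, f e • (G.cycVec (p (G.s e.1)) - G.cycVec (p (G.t e.1))) = 0 := by
      have h1 : ∀ e : F, G.cycVec (p (G.s e.1)) - G.cycVec (p (G.t e.1)) =
          ∑ w ∈ S, ((if G.s e.1 = w then (1:ℝ) else 0) -
        (if G.t e.1 = w then 1 else 0)) • G.cycVec (p w) := by
        intro e
        simp [sub_smul, Finset.sum_sub_distrib, ite_smul, (hF e.1 e.2).1, (hF e.1 e.2).2]
      simp_rw [h1, Finset.smul_sum, smul_smul]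
      rw [Finset.sum_comm]
      apply Finset.sum_eq_zero
      intro w hw
      by_cases hwx : w = x
      · subst hwx; simp [hPx]
      · rw [← Finset.sum_smul, hD' w hw hwx, zero_smul]
    have h2 : ∑ e : F, f e • (Pi.single e.1 1 : G.E → ℝ) = 0 := by
      have : ∑ e : F, f e • v e =
          ∑ e : F, f e • (G.cycVec (p (G.s e.1)) - G.cycVec (p (G.t e.1))) +
          ∑ e : F, f e • (Pi.single e.1 1 : G.E → ℝ) := by
        rw [← Finset.sum_add_distrib]
        refine Finset.sum_congr rfl fun e _ => ?_
        rw [← smul_add]; congr 1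
        simp only [v, cycVec_eloop]; abel
      rw [hf', key, zero_add] at this
      exact this.symm
    ext e
    have h3 := congrFun h2 e.1
    simp only [Finset.sum_apply, Pi.smul_apply, Pi.single_apply, smul_eq_mul, mul_ite, mul_one,
      mul_zero, Pi.zero_apply] at h3
    rw [Finset.sum_eq_single e] at h3
    · simpa using h3
    · intro b _ hb
      rw [if_neg]; intro h; exact hb (Subtype.ext h.symm)
    · simp
  have hker := LinearMap.finrank_le_finrank_of_injective hinj
  have hrk := Φ.finrank_range_add_finrank_ker
  have hr : LinearMap.range Φ = Submodule.span ℝ (Set.range v) :=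
    Fintype.range_linearCombination ℝ v
  rw [hr] at hrk
  simp only [Module.finrank_fintype_fun_eq_card, Fintype.card_coe] at hker hrk
  rw [Finset.card_erase_of_mem hx] at hker
  have hSpos : 0 < S.card := Finset.card_pos.2 ⟨x, hx⟩
  have hge : n ≤ Module.finrank ℝ (Submodule.span ℝ (Set.range v)) := by omega
  obtain ⟨g, hg⟩ := Submodule.exists_fun_fin_finrank_span_eq ℝ (Set.range v)
  obtain ⟨hg1, -, hg3⟩ := hg
  choose a ha using hg1
  refine ⟨fun i => (a (Fin.castLE hge i)).1, fun i => (a _).2, ?_⟩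
  have := hg3.comp (Fin.castLE hge) (Fin.castLE_injective hge)
  have heq : (fun i => G.cycVec (eloop p (a (Fin.castLE hge i)).1)) = g ∘ Fin.castLE hge := by
    funext i
    simp only [Function.comp, ← ha, v]
  rw [heq]
  exact this

/-! ### Growth of balls -/

/-- The length of the part of an edge (of length `ℓ`, with end points at distance `a`, `b`)
covered by the ball of radius `s`. -/
noncomputable def vol (a b ℓ s : ℝ) : ℝ := min ℓ (max 0 (s - a) + max 0 (s - b))

open Classical in
/-- The number of boundary points of the ball of radius `s` on an edge. -/
noncomputable def bd (a b ℓ s : ℝ) : ℝ :=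
  if max 0 (s - a) + max 0 (s - b) < ℓ then (if a ≤ s then 1 else 0) + (if b ≤ s then 1 else 0)
  else 0

open Classical in
theorem hasDeriv_max (a s : ℝ) :
    HasDerivWithinAt (fun s => max 0 (s - a)) (if a ≤ s then 1 else 0) (Set.Ici s) s := by
  split_ifs with h
  · have : HasDerivWithinAt (fun s => s - a) 1 (Set.Ici s) s :=
      ((hasDerivAt_id s).sub_const a).hasDerivWithinAt
    refine this.congr (fun y hy => ?_) ?_
    · simp only [Set.mem_Ici] at hy; rw [max_eq_right]; linarith
    · rw [max_eq_right]; linarith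
  · push Not at h
    have : HasDerivWithinAt (fun _ : ℝ => (0:ℝ)) 0 (Set.Ici s) s := hasDerivWithinAt_const _ _ _
    refine this.congr_of_eventuallyEq ?_ ?_
    · have : ∀ᶠ y in nhdsWithin s (Set.Ici s), y < a :=
        nhdsWithin_le_nhds (eventually_lt_nhds h)
      filter_upwards [this] with y hy
      rw [max_eq_left]; linarith
    · rw [max_eq_left]; linarith

theorem hasDeriv_vol (a b ℓ s : ℝ) :
    HasDerivWithinAt (vol a b ℓ) (bd a b ℓ s) (Set.Ici s) s := by
  have hsum := (hasDeriv_max a s).add (hasDeriv_max b s)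
  unfold bd
  by_cases h : max 0 (s - a) + max 0 (s - b) < ℓ
  · rw [if_pos h]
    refine hsum.congr_of_eventuallyEq ?_ ?_
    · have hc : Continuous fun s : ℝ => max 0 (s - a) + max 0 (s - b) := by fun_prop
      have : ∀ᶠ y in nhdsWithin s (Set.Ici s), max 0 (y - a) + max 0 (y - b) < ℓ :=
        nhdsWithin_le_nhds (hc.continuousAt.eventually_lt continuousAt_const h)
      filter_upwards [this] with y hy
      simp only [vol, Pi.add_apply]; exact min_eq_right hy.le
    · simp only [vol, Pi.add_apply]; exact min_eq_right h.le
  · rw [if_neg h]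
    push Not at h
    have : HasDerivWithinAt (fun _ : ℝ => ℓ) 0 (Set.Ici s) s := hasDerivWithinAt_const _ _ _
    refine this.congr (fun y hy => ?_) ?_
    · simp only [Set.mem_Ici] at hy
      refine min_eq_left (h.trans ?_)
      gcongr
    · exact min_eq_left h

theorem continuous_vol (a b ℓ : ℝ) : Continuous (vol a b ℓ) := by
  unfold vol; fun_prop

theorem vol_mono (a b ℓ : ℝ) : Monotone (vol a b ℓ) := by
  intro s t h
  unfold vol
  gcongr

theorem growth {ι : Type*} (A : Finset ι) (a b ℓ : ι → ℝ) (hℓ : ∀ e, 0 ≤ ℓ e) {r₀ R ε : ℝ}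
    (h0 : 0 ≤ r₀) (hR : r₀ ≤ R)
    (h1 : ∀ s, 0 ≤ s → s < r₀ → 1 ≤ ∑ e ∈ A, bd (a e) (b e) (ℓ e) s)
    (h2 : ∀ s, r₀ ≤ s → s < R → ε * ∑ e ∈ A, vol (a e) (b e) (ℓ e) s <
      ∑ e ∈ A, bd (a e) (b e) (ℓ e) s) :
    r₀ * Real.exp (ε * (R - r₀)) ≤ ∑ e ∈ A, ℓ e := by
  set V : ℝ → ℝ := fun s => ∑ e ∈ A, vol (a e) (b e) (ℓ e) s with hV
  have hVc : Continuous V := continuous_finsetSum _ fun e _ => continuous_vol _ _ _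
  have hVd : ∀ s, HasDerivWithinAt V (∑ e ∈ A, bd (a e) (b e) (ℓ e) s) (Set.Ici s) s := fun s =>
    HasDerivWithinAt.fun_sum fun e _ => hasDeriv_vol _ _ _ _
  have hV0 : 0 ≤ V 0 := Finset.sum_nonneg fun e _ => le_min (hℓ e) (by positivity)
  have hVr0 : r₀ ≤ V r₀ := by
    refine image_le_of_deriv_right_le_deriv_boundary (f := fun s => s) (f' := fun _ => 1)
      (a := 0) (b := r₀) continuousOn_id (fun x _ => (hasDerivAt_id x).hasDerivWithinAt) hV0
      hVc.continuousOn (fun x _ => hVd x) (fun x hx => h1 x hx.1 hx.2) ⟨h0, le_rfl⟩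
  have hVR : r₀ * Real.exp (ε * (R - r₀)) ≤ V R := by
    have hd : ∀ x, HasDerivAt (fun s => r₀ * Real.exp (ε * (s - r₀)))
        (ε * (r₀ * Real.exp (ε * (x - r₀)))) x := by
      intro x
      have := ((((hasDerivAt_id' x).sub_const r₀).const_mul ε).exp).const_mul r₀
      have h3 : ε * (r₀ * Real.exp (ε * (x - r₀))) =
          r₀ * (Real.exp (ε * (x - r₀)) * (ε * 1)) := by ring
      rw [h3]
      exact this
    refine image_le_of_deriv_right_lt_deriv_boundary'
      (f := fun s => r₀ * Real.exp (ε * (s - r₀)))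
      (f' := fun x => ε * (r₀ * Real.exp (ε * (x - r₀))))
      (a := r₀) (b := R) (by fun_prop) (fun x _ => (hd x).hasDerivWithinAt) (by simpa using hVr0)
      hVc.continuousOn (fun x _ => hVd x) (fun x hx he => ?_) ⟨hR, le_rfl⟩
    rw [he]
    exact h2 x hx.1 hx.2
  refine hVR.trans (Finset.sum_le_sum fun e _ => min_le_left _ _)

theorem initial_growth {ι : Type*} (A : Finset ι) (a b ℓ : ι → ℝ) (hℓ : ∀ e, 0 ≤ ℓ e) {r₀ : ℝ}
    (h0 : 0 ≤ r₀)
    (h1 : ∀ s, 0 ≤ s → s < r₀ → 1 ≤ ∑ e ∈ A, bd (a e) (b e) (ℓ e) s) :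
    r₀ ≤ ∑ e ∈ A, vol (a e) (b e) (ℓ e) r₀ := by
  set V : ℝ → ℝ := fun s => ∑ e ∈ A, vol (a e) (b e) (ℓ e) s with hV
  have hVc : Continuous V := continuous_finsetSum _ fun e _ => continuous_vol _ _ _
  have hVd : ∀ s, HasDerivWithinAt V (∑ e ∈ A, bd (a e) (b e) (ℓ e) s) (Set.Ici s) s := fun s =>
    HasDerivWithinAt.fun_sum fun e _ => hasDeriv_vol _ _ _ _
  have hV0 : 0 ≤ V 0 := Finset.sum_nonneg fun e _ => le_min (hℓ e) (by positivity)
  exact image_le_of_deriv_right_le_deriv_boundary (f := fun s => s) (f' := fun _ => 1)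
      (a := 0) (b := r₀) continuousOn_id (fun x _ => (hasDerivAt_id x).hasDerivWithinAt) hV0
      hVc.continuousOn (fun x _ => hVd x) (fun x hx => h1 x hx.1 hx.2) ⟨h0, le_rfl⟩

/-- If every level in `(a, b)` is crossed by an edge, the total length is at least `b - a`. -/
theorem coarea {ι : Type*} (A : Finset ι) (f g ℓ : ι → ℝ)
    (h1 : ∀ e, f e ≤ g e + ℓ e) (h2 : ∀ e, g e ≤ f e + ℓ e) {a b : ℝ}
    (h : ∀ σ, a < σ → σ < b → ∃ e ∈ A, (f e ≤ σ ∧ σ ≤ g e) ∨ (g e ≤ σ ∧ σ ≤ f e)) :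
    b - a ≤ ∑ e ∈ A, ℓ e := by
  have hsub : Set.Ioo a b ⊆ ⋃ e ∈ A, Set.Icc (min (f e) (g e)) (max (f e) (g e)) := by
    intro σ hσ
    obtain ⟨e, he, h'⟩ := h σ hσ.1 hσ.2
    simp only [Set.mem_iUnion, Set.mem_Icc, min_le_iff, le_max_iff]
    exact ⟨e, he, by tauto⟩
  have := (MeasureTheory.measure_mono (μ := MeasureTheory.volume) hsub).trans
    (MeasureTheory.measure_biUnion_finset_le A _)
  simp only [Real.volume_Ioo, Real.volume_Icc] at this
  rw [← ENNReal.ofReal_sum_of_nonneg (fun e _ => by simp)] at this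
  have hnn : 0 ≤ ∑ e ∈ A, (max (f e) (g e) - min (f e) (g e)) :=
    Finset.sum_nonneg fun e _ => by simp
  refine ((ENNReal.ofReal_le_ofReal_iff hnn).1 this).trans (Finset.sum_le_sum fun e _ => ?_)
  have := h1 e; have := h2 e
  rcases le_total (f e) (g e) with h | h <;> simp [h] <;> linarith

/-! ### Distances -/

theorem vdist_bdd (x v : G.V) : BddBelow {y | ∃ l, G.IsWalk x v l ∧ G.walkLen l = y} :=
  ⟨0, by rintro y ⟨l, -, rfl⟩; exact walkLen_nonneg l⟩

theorem vdist_le {x v : G.V} {l : List (G.E × Bool)} (h : G.IsWalk x v l) :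
    G.vdist x v ≤ G.walkLen l := csInf_le (vdist_bdd x v) ⟨l, h, rfl⟩

theorem exists_walk_lt (hc : G.Connected) (x v : G.V) {η : ℝ} (hη : 0 < η) :
    ∃ l, G.IsWalk x v l ∧ G.walkLen l < G.vdist x v + η := by
  have hne : {y | ∃ l, G.IsWalk x v l ∧ G.walkLen l = y}.Nonempty := by
    obtain ⟨l, hl⟩ := hc x v
    exact ⟨_, l, hl, rfl⟩
  obtain ⟨y, ⟨l, hl, rfl⟩, hy⟩ := exists_lt_of_csInf_lt hne
    (show sInf {y | ∃ l, G.IsWalk x v l ∧ G.walkLen l = y} < G.vdist x v + η by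
      unfold vdist; linarith)
  exact ⟨l, hl, hy⟩

theorem vdist_self_le (x : G.V) : G.vdist x x ≤ 0 := by
  have := vdist_le (G := G) (x := x) (v := x) (l := []) rfl
  simpa [walkLen] using this

theorem vdist_step (hc : G.Connected) (x : G.V) (d : G.E × Bool) :
    G.vdist x (G.dend d) ≤ G.vdist x (G.dstart d) + G.len d.1 := by
  refine le_of_forall_pos_le_add fun η hη => ?_
  obtain ⟨l, hl, hlt⟩ := exists_walk_lt hc x (G.dstart d) hη
  have hw : G.IsWalk x (G.dend d) (l ++ [d]) := hl.append ⟨rfl, rfl⟩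
  have := vdist_le hw
  rw [walkLen_append] at this
  have h1 : G.walkLen [d] = G.len d.1 := by simp [walkLen]
  linarith

theorem vdist_t (hc : G.Connected) (x : G.V) (e : G.E) :
    G.vdist x (G.t e) ≤ G.vdist x (G.s e) + G.len e := by
  simpa [dend, dstart] using vdist_step hc x (e, true)

theorem vdist_s (hc : G.Connected) (x : G.V) (e : G.E) :
    G.vdist x (G.s e) ≤ G.vdist x (G.t e) + G.len e := by
  simpa [dend, dstart] using vdist_step hc x (e, false)

/-! ### Vertex sets -/

/-- Edges with both ends in `S`. -/
def ES (S : Finset G.V) : Finset G.E := Finset.univ.filter fun e => G.s e ∈ S ∧ G.t e ∈ S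

theorem mem_ES {S : Finset G.V} {e : G.E} : e ∈ ES S ↔ G.s e ∈ S ∧ G.t e ∈ S := by simp [ES]

/-- The degree mass of a set of vertices. -/
noncomputable def W (B : Finset G.V) : ℝ :=
  ∑ e, G.len e * ((if G.s e ∈ B then 1 else 0) + (if G.t e ∈ B then 1 else 0))

theorem W_mono {A B : Finset G.V} (h : A ⊆ B) : W A ≤ W B := by
  unfold W
  refine Finset.sum_le_sum fun e _ => mul_le_mul_of_nonneg_left ?_ (G.len_nonneg e)
  have key : ∀ v : G.V, (if v ∈ A then (1:ℝ) else 0) ≤ if v ∈ B then 1 else 0 := by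
    intro v
    by_cases h1 : v ∈ A
    · rw [if_pos h1, if_pos (h h1)]
    · rw [if_neg h1]; positivity
  exact add_le_add (key _) (key _)

theorem W_sdiff {A B : Finset G.V} (h : A ⊆ B) : W B = W A + W (B \ A) := by
  unfold W
  rw [← Finset.sum_add_distrib]
  refine Finset.sum_congr rfl fun e _ => ?_
  rw [← mul_add]; congr 1
  by_cases h1 : G.s e ∈ A <;> by_cases h2 : G.t e ∈ A <;>
  by_cases h3 : G.s e ∈ B <;> by_cases h4 : G.t e ∈ B <;>
    first
    | exact absurd (h h1) h3
    | exact absurd (h h2) h4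
    | (simp [h1, h2, h3, h4]; try norm_num)

theorem W_univ : W (Finset.univ : Finset G.V) = 2 * G.totalLength := by
  unfold W totalLength
  rw [Finset.mul_sum]
  refine Finset.sum_congr rfl fun e _ => ?_
  simp; ring

theorem sum_touch_le_W (T : Finset G.V) (A : Finset G.E) (h : ∀ e ∈ A, G.s e ∈ T ∨ G.t e ∈ T) :
    ∑ e ∈ A, G.len e ≤ W T := by
  unfold W
  calc ∑ e ∈ A, G.len e ≤ ∑ e ∈ A, G.len e * ((if G.s e ∈ T then 1 else 0) +
        (if G.t e ∈ T then 1 else 0)) := by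
        refine Finset.sum_le_sum fun e he => ?_
        have h0 := G.len_nonneg e
        rcases h e he with h1 | h1
        · rw [if_pos h1]; split_ifs <;> linarith
        · rw [if_pos h1]; split_ifs <;> linarith
    _ ≤ _ := Finset.sum_le_sum_of_subset_of_nonneg (Finset.subset_univ _) (by
        intro e _ _
        exact mul_nonneg (G.len_nonneg e) (by positivity))

/-- An edge inside `T` has length at most half the mass. -/
theorem len_le_W (T : Finset G.V) (e : G.E) (h1 : G.s e ∈ T) (h2 : G.t e ∈ T) :
    2 * G.len e ≤ W T := by
  unfold W
  have := Finset.single_le_sum (f := fun e => G.len e * ((if G.s e ∈ T then (1:ℝ) else 0) +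
        (if G.t e ∈ T then 1 else 0)))
    (fun e _ => mul_nonneg (G.len_nonneg e) (by positivity)) (Finset.mem_univ e)
  simp only [h1, h2, if_true] at this
  linarith

/-- `T` is a union of components of `G[S]`. -/
def Closed (T S : Finset G.V) : Prop :=
  ∀ e : G.E, (G.s e ∈ T → G.t e ∈ S → G.t e ∈ T) ∧ (G.t e ∈ T → G.s e ∈ S → G.s e ∈ T)

theorem closed_univ (hc : G.Connected) {T : Finset G.V} (hT : T.Nonempty)
    (h : Closed T Finset.univ) : T = Finset.univ := by
  obtain ⟨x, hx⟩ := hT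
  refine Finset.eq_univ_of_forall fun v => ?_
  obtain ⟨l, hl⟩ := hc x v
  induction l generalizing x with
  | nil => simp only [IsWalk] at hl; rwa [← hl]
  | cons d l ih =>
    refine ih (G.dend d) ?_ hl.2
    have h1 := hl.1
    rw [← h1] at hx
    obtain ⟨e, o⟩ := d
    cases o
    · simpa [dend] using (h e).2 (by simpa [dstart] using hx) (Finset.mem_univ _)
    · simpa [dend] using (h e).1 (by simpa [dstart] using hx) (Finset.mem_univ _)

/-- Total boundary count of the ball in `G[S]`. -/
noncomputable def BD (S : Finset G.V) (x : G.V) (r : ℝ) : ℝ :=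
  ∑ e ∈ ES S, bd (G.vdist x (G.s e)) (G.vdist x (G.t e)) (G.len e) r

open Classical in
/-- The ball in `S`. -/
noncomputable def ball (S : Finset G.V) (x : G.V) (r : ℝ) : Finset G.V :=
  S.filter fun v => G.vdist x v ≤ r

theorem mem_ball {S : Finset G.V} {x v : G.V} {r : ℝ} :
    v ∈ ball S x r ↔ v ∈ S ∧ G.vdist x v ≤ r := by simp [ball]

theorem bd_nonneg (a b ℓ r : ℝ) : 0 ≤ bd a b ℓ r := by
  unfold bd; positivity

theorem one_le_bd {a b ℓ r : ℝ} (h1 : a ≤ b + ℓ) (h2 : b ≤ a + ℓ) (ht : a ≤ r ∨ b ≤ r)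
    (hs : ¬ (a ≤ r ∧ b ≤ r ∧ a + ℓ + b ≤ 2 * r)) : 1 ≤ bd a b ℓ r := by
  unfold bd
  by_cases ha : a ≤ r <;> by_cases hb : b ≤ r
  · have hs' : 2 * r < a + ℓ + b := by
      by_contra h; exact hs ⟨ha, hb, not_lt.1 h⟩
    rw [max_eq_right (by linarith), max_eq_right (by linarith), if_pos (by linarith)]
    simp [ha, hb]
  · rw [max_eq_right (by linarith), max_eq_left (by linarith), if_pos (by linarith)]
    simp [ha, hb]
  · rw [max_eq_left (by linarith), max_eq_right (by linarith), if_pos (by linarith)]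
    simp [ha, hb]
  · tauto

theorem vol_le_W (S : Finset G.V) (x : G.V) (r : ℝ) :
    ∑ e ∈ ES S, vol (G.vdist x (G.s e)) (G.vdist x (G.t e)) (G.len e) r ≤ W (ball S x r) := by
  classical
  have h1 : ∑ e ∈ ES S, vol (G.vdist x (G.s e)) (G.vdist x (G.t e)) (G.len e) r ≤
      ∑ e ∈ (ES S).filter (fun e => G.s e ∈ ball S x r ∨ G.t e ∈ ball S x r), G.len e := by
    rw [Finset.sum_filter]
    refine Finset.sum_le_sum fun e he => ?_
    rw [mem_ES] at he
    split_ifs with h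
    · exact min_le_left _ _
    · simp only [mem_ball, he, true_and, not_or, not_le] at h
      refine (min_le_right _ _).trans ?_
      rw [max_eq_left (by linarith), max_eq_left (by linarith)]; simp
  refine h1.trans (sum_touch_le_W _ _ fun e he => (Finset.mem_filter.1 he).2)

/-- Every union of components of `G[S]` is heavy. -/
def Inv (m : ℝ) (S : Finset G.V) : Prop :=
  ∀ T ⊆ S, T.Nonempty → Closed T S → m ≤ W T

theorem exists_radius (hc : G.Connected) {n b : ℕ} (hn : 1 ≤ n) (hb : 2 ≤ b) {u : ℝ} (hu : 0 < u)
    (hL : G.totalLength ≤ b * u) {S : Finset G.V} {x : G.V} (hx : x ∈ S)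
    (hI : Inv (4 * n * u) S) :
    ∃ r, 0 ≤ r ∧ r ≤ 4 * n * u + 4 * u * Real.log b ∧ 4 * n * u ≤ W (ball S x r) ∧
      BD S x r ≤ W (ball S x r) / (4 * u) := by
  have hn' : (1:ℝ) ≤ n := by exact_mod_cast hn
  have hb' : (2:ℝ) ≤ b := by exact_mod_cast hb
  have hlog : 0 < Real.log b := Real.log_pos (by linarith)
  set R := 4 * n * u + 4 * u * Real.log b with hR
  have hr0 : 4 * n * u ≤ R := by rw [hR]; nlinarith
  have hnu : u ≤ n * u := by nlinarith
  by_cases hA : ∃ s, 0 ≤ s ∧ s ≤ R ∧ BD S x s < 1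
  · obtain ⟨s, hs0, hsR, hs⟩ := hA
    have hcl : Closed (ball S x s) S := by
      intro e
      have key : e ∈ ES S → (G.vdist x (G.s e) ≤ s ∨ G.vdist x (G.t e) ≤ s) →
          (G.vdist x (G.s e) ≤ s ∧ G.vdist x (G.t e) ≤ s) := by
        intro he ht
        by_contra hcon
        have h1 := one_le_bd (ℓ := G.len e) (vdist_s hc x e) (vdist_t hc x e) ht (by tauto)
        have h2 := Finset.single_le_sum
          (f := fun e => bd (G.vdist x (G.s e)) (G.vdist x (G.t e)) (G.len e) s)
          (fun e _ => bd_nonneg _ _ _ _) he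
        unfold BD at hs
        linarith
      simp only [mem_ball, mem_ES] at *
      tauto
    have hW : 4 * n * u ≤ W (ball S x s) :=
      hI _ (fun v hv => (mem_ball.1 hv).1) ⟨x, mem_ball.2 ⟨hx, (vdist_self_le x).trans hs0⟩⟩ hcl
    refine ⟨s, hs0, hsR, hW, ?_⟩
    rw [le_div_iff₀ (by positivity)]
    nlinarith
  · push Not at hA
    by_contra hcon
    push Not at hcon
    have hini := initial_growth (ES S) (fun e => G.vdist x (G.s e)) (fun e => G.vdist x (G.t e))
      G.len G.len_nonneg (r₀ := 4 * n * u) (by positivity)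
      (fun s hs hs' => hA s hs (hs'.le.trans hr0))
    have hg := growth (ES S) (fun e => G.vdist x (G.s e)) (fun e => G.vdist x (G.t e))
      G.len G.len_nonneg (r₀ := 4 * n * u) (R := R) (ε := 1 / (4 * u)) (by positivity) hr0
      (fun s hs hs' => hA s hs (hs'.le.trans hr0)) (by
        intro s hs hs'
        have hV := vol_le_W S x s
        have h4 : 4 * n * u ≤ W (ball S x s) := by
          refine (hini.trans ?_).trans hV
          exact Finset.sum_le_sum fun e _ => vol_mono _ _ _ hs
        refine lt_of_le_of_lt ?_ (hcon s (by nlinarith) hs'.le h4)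
        rw [div_mul_eq_mul_div, one_mul]
        exact div_le_div_of_nonneg_right hV (by positivity))
    have hexp : 1 / (4 * u) * (R - 4 * n * u) = Real.log b := by
      rw [hR]; field_simp; ring
    rw [hexp, Real.exp_log (by linarith)] at hg
    have : ∑ e ∈ ES S, G.len e ≤ G.totalLength :=
      Finset.sum_le_sum_of_subset_of_nonneg (Finset.subset_univ _) (fun e _ _ => G.len_nonneg e)
    have hbu : 0 < b * u := by positivity
    nlinarith

/-! ### The main induction -/

set_option maxHeartbeats 2000000 in
theorem main_induction (hc : G.Connected) {n b : ℕ} (hn : 1 ≤ n) (hb : 2 ≤ b) {u : ℝ}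
    (hu : 0 < u) (hL : G.totalLength ≤ b * u)
    (hyp : ∀ x, ∀ S : Finset G.V, x ∈ S → ∀ F : Finset G.E,
      (∀ e ∈ F, G.s e ∈ S ∧ G.t e ∈ S) →
      (∀ e ∈ F, G.vdist x (G.s e) + G.len e + G.vdist x (G.t e) ≤
        2 * (9 * n * u + 4 * u * Real.log b)) → F.card + 2 ≤ S.card + n)
    (k : ℕ) : ∀ S : Finset G.V, S.card = k → Inv (4 * n * u) S →
      S = ∅ ∨ ((ES S).card : ℝ) + 2 ≤ S.card + W S / (2 * u) := by
  classical
  induction k using Nat.strong_induction_on with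
  | _ k ih =>
  intro S hSk hI
  by_cases hSe : S = ∅
  · exact Or.inl hSe
  right
  obtain ⟨x, hx⟩ := Finset.nonempty_iff_ne_empty.2 hSe
  obtain ⟨r, hr0, hrR, hWB, hBD⟩ := exists_radius hc hn hb hu hL hx hI
  have hnu : 0 < n * u := by
    have : (1:ℝ) ≤ n := by exact_mod_cast hn
    positivity
  set B := ball S x r with hB
  have hBS : B ⊆ S := fun v hv => (mem_ball.1 hv).1
  have hxB : x ∈ B := mem_ball.2 ⟨hx, (vdist_self_le x).trans hr0⟩
  set K : Finset G.V := (S \ B).filter fun v =>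
    ∃ T ⊆ S \ B, Closed T (S \ B) ∧ W T < 4 * n * u ∧ v ∈ T with hK
  have hKS : K ⊆ S \ B := Finset.filter_subset _ _
  have hKmem : ∀ T ⊆ S \ B, Closed T (S \ B) → W T < 4 * n * u → T ⊆ K := by
    intro T hT h1 h2 v hv
    exact Finset.mem_filter.2 ⟨hT hv, T, hT, h1, h2, hv⟩
  have hKcl : Closed K (S \ B) := by
    intro e
    constructor
    · intro h1 h2
      obtain ⟨_, T, hT, hTc, hTW, hvT⟩ := Finset.mem_filter.1 h1
      exact hKmem T hT hTc hTW ((hTc e).1 hvT h2)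
    · intro h1 h2
      obtain ⟨_, T, hT, hTc, hTW, hvT⟩ := Finset.mem_filter.1 h1
      exact hKmem T hT hTc hTW ((hTc e).2 hvT h2)
  -- depth of light pieces
  have hKd : ∀ v ∈ K, G.vdist x v ≤ r + 4 * n * u := by
    intro v hv
    obtain ⟨_, T, hT, hTc, hTW, hvT⟩ := Finset.mem_filter.1 hv
    have hco := coarea (Finset.univ.filter fun e => G.s e ∈ T ∨ G.t e ∈ T)
      (fun e => G.vdist x (G.s e)) (fun e => G.vdist x (G.t e)) G.len
      (vdist_s hc x) (vdist_t hc x) (a := r) (b := G.vdist x v) (by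
        intro σ h1 h2
        set Tσ := T.filter fun w => σ ≤ G.vdist x w with hTσ
        have hsub : Tσ ⊆ T := Finset.filter_subset _ _
        have hTS : T ⊆ S := hT.trans Finset.sdiff_subset
        have hncl : ¬ Closed Tσ S := by
          intro hcl
          have := hI Tσ (hsub.trans hTS) ⟨v, Finset.mem_filter.2 ⟨hvT, h2.le⟩⟩ hcl
          have := W_mono hsub
          linarith
        have low : ∀ w ∈ S, w ∉ Tσ → (w ∈ S \ B → w ∈ T) → G.vdist x w ≤ σ := by
          intro w hw hwT hwB
          by_cases hwb : w ∈ B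
          · exact (mem_ball.1 hwb).2.trans h1.le
          · have hwT' := hwB (Finset.mem_sdiff.2 ⟨hw, hwb⟩)
            by_contra hlt
            exact hwT (Finset.mem_filter.2 ⟨hwT', (not_le.1 hlt).le⟩)
        unfold Closed at hncl
        push Not at hncl
        obtain ⟨e, he⟩ := hncl
        refine ⟨e, ?_⟩
        by_cases hcase : G.s e ∈ Tσ ∧ G.t e ∈ S ∧ G.t e ∉ Tσ
        · obtain ⟨a1, a2, a3⟩ := hcase
          refine ⟨by simp [hsub a1], Or.inr ⟨?_, (Finset.mem_filter.1 a1).2⟩⟩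
          exact low _ a2 a3 fun h => (hTc e).1 (hsub a1) h
        · have : G.t e ∈ Tσ ∧ G.s e ∈ S ∧ G.s e ∉ Tσ := by
            by_contra hh; tauto
          obtain ⟨a1, a2, a3⟩ := this
          refine ⟨by simp [hsub a1], Or.inl ⟨?_, (Finset.mem_filter.1 a1).2⟩⟩
          exact low _ a2 a3 fun h => (hTc e).2 (hsub a1) h)
    have := sum_touch_le_W T (Finset.univ.filter fun e => G.s e ∈ T ∨ G.t e ∈ T)
      (fun e he => (Finset.mem_filter.1 he).2)
    linarith
  have hKlen : ∀ e, G.s e ∈ K → G.t e ∈ K → G.len e ≤ 2 * n * u := by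
    intro e h1 h2
    obtain ⟨_, T, hT, hTc, hTW, hvT⟩ := Finset.mem_filter.1 h1
    have := len_le_W T e hvT ((hTc e).1 hvT (hKS h2))
    linarith
  set B' := B ∪ K with hB'
  have hBB' : B ⊆ B' := Finset.subset_union_left
  have hB'S : B' ⊆ S := Finset.union_subset hBS (hKS.trans Finset.sdiff_subset)
  -- the remainder
  have hI' : Inv (4 * n * u) (S \ B') := by
    intro T hT hTne hTc
    by_contra hlt
    push Not at hlt
    have hTSB : T ⊆ S \ B := hT.trans (Finset.sdiff_subset_sdiff le_rfl hBB')
    have hTK : ∀ w ∈ T, w ∉ K := fun w hw hwK =>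
      (Finset.mem_sdiff.1 (hT hw)).2 (Finset.mem_union_right _ hwK)
    have hmem : ∀ w, w ∈ S \ B → w ∉ K → w ∈ S \ B' := by
      intro w h1 h2
      rw [Finset.mem_sdiff] at h1 ⊢
      refine ⟨h1.1, fun h => ?_⟩
      rcases Finset.mem_union.1 h with h | h
      · exact h1.2 h
      · exact h2 h
    have hcl : Closed T (S \ B) := by
      intro e
      constructor
      · intro h1 h2
        exact (hTc e).1 h1 (hmem _ h2 fun h => hTK _ h1 ((hKcl e).2 h (hTSB h1)))
      · intro h1 h2
        exact (hTc e).2 h1 (hmem _ h2 fun h => hTK _ h1 ((hKcl e).1 h (hTSB h1)))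
    obtain ⟨w, hw⟩ := hTne
    exact hTK w hw (hKmem T hTSB hcl hlt hw)
  set F := (ES B').filter fun e => G.vdist x (G.s e) + G.len e + G.vdist x (G.t e) ≤
        2 * (9 * n * u + 4 * u * Real.log b) with hF
  have hFc : F.card + 2 ≤ B'.card + n :=
    hyp x B' (hBB' hxB) F (fun e he => mem_ES.1 (Finset.mem_filter.1 he).1)
      (fun e he => (Finset.mem_filter.1 he).2)
  set C := (ES S).filter fun e =>
    1 ≤ bd (G.vdist x (G.s e)) (G.vdist x (G.t e)) (G.len e) r with hC
  have hCc : (C.card : ℝ) ≤ BD S x r := by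
    have h1 : (C.card : ℝ) ≤
        ∑ e ∈ C, bd (G.vdist x (G.s e)) (G.vdist x (G.t e)) (G.len e) r := by
      rw [Finset.card_eq_sum_ones]
      push_cast
      exact Finset.sum_le_sum fun e he => (Finset.mem_filter.1 he).2
    exact h1.trans (Finset.sum_le_sum_of_subset_of_nonneg (Finset.filter_subset _ _)
      fun e _ _ => bd_nonneg _ _ _ _)
  have hcover : ES S ⊆ ES (S \ B') ∪ (F ∪ C) := by
    intro e he
    have heS := mem_ES.1 he
    by_cases heC : e ∈ C
    · simp [heC]
    have hbd : ¬ 1 ≤ bd (G.vdist x (G.s e)) (G.vdist x (G.t e)) (G.len e) r :=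
      fun h => heC (Finset.mem_filter.2 ⟨he, h⟩)
    by_cases ht : G.vdist x (G.s e) ≤ r ∨ G.vdist x (G.t e) ≤ r
    · by_cases hs : G.vdist x (G.s e) ≤ r ∧ G.vdist x (G.t e) ≤ r ∧
        G.vdist x (G.s e) + G.len e + G.vdist x (G.t e) ≤ 2 * r
      · refine Finset.mem_union_right _ (Finset.mem_union_left _ (Finset.mem_filter.2 ⟨?_, ?_⟩))
        · exact mem_ES.2 ⟨hBB' (mem_ball.2 ⟨heS.1, hs.1⟩), hBB' (mem_ball.2 ⟨heS.2, hs.2.1⟩)⟩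
        · linarith [hs.2.2]
      · exact absurd (one_le_bd (vdist_s hc x e) (vdist_t hc x e) ht hs) hbd
    · push Not at ht
      have hs1 : G.s e ∈ S \ B :=
        Finset.mem_sdiff.2 ⟨heS.1, fun h => absurd (mem_ball.1 h).2 (not_le.2 ht.1)⟩
      have ht1 : G.t e ∈ S \ B :=
        Finset.mem_sdiff.2 ⟨heS.2, fun h => absurd (mem_ball.1 h).2 (not_le.2 ht.2)⟩
      by_cases hsK : G.s e ∈ K
      · have htK := (hKcl e).1 hsK ht1
        refine Finset.mem_union_right _ (Finset.mem_union_left _ (Finset.mem_filter.2 ⟨?_, ?_⟩))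
        · exact mem_ES.2 ⟨Finset.mem_union_right _ hsK, Finset.mem_union_right _ htK⟩
        · have := hKd _ hsK; have := hKd _ htK; have := hKlen e hsK htK
          linarith
      · have htK : G.t e ∉ K := fun h => hsK ((hKcl e).2 h hs1)
        refine Finset.mem_union_left _ (mem_ES.2 ?_)
        refine ⟨Finset.mem_sdiff.2 ⟨heS.1, fun h => ?_⟩, Finset.mem_sdiff.2 ⟨heS.2, fun h => ?_⟩⟩
        · exact (Finset.mem_union.1 h).elim (Finset.mem_sdiff.1 hs1).2 hsK
        · exact (Finset.mem_union.1 h).elim (Finset.mem_sdiff.1 ht1).2 htK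
  have hcard : (ES S).card ≤ (ES (S \ B')).card + (F.card + C.card) :=
    (Finset.card_le_card hcover).trans ((Finset.card_union_le _ _).trans
      (Nat.add_le_add_left (Finset.card_union_le _ _) _))
  have hcard' : ((ES S).card : ℝ) ≤ (ES (S \ B')).card + (F.card + C.card) := by
    exact_mod_cast hcard
  have hFc' : (F.card : ℝ) + 2 ≤ B'.card + n := by exact_mod_cast hFc
  have hScard : (S.card : ℝ) = (S \ B').card + B'.card := by
    exact_mod_cast (Finset.card_sdiff_add_card_eq_card hB'S).symm
  have hWS : W S = W B' + W (S \ B') := W_sdiff hB'S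
  have hWBB' : W B ≤ W B' := W_mono hBB'
  have hstep : (n : ℝ) + W B / (4 * u) ≤ W B' / (2 * u) := by
    have h1 : (n : ℝ) ≤ W B / (4 * u) := by
      rw [le_div_iff₀ (by positivity)]; linarith
    have h2 : W B / (4 * u) + W B / (4 * u) = W B / (2 * u) := by field_simp; ring
    have h3 : W B / (2 * u) ≤ W B' / (2 * u) := div_le_div_of_nonneg_right hWBB' (by positivity)
    linarith
  have hIH : ((ES (S \ B')).card : ℝ) ≤ (S \ B').card + W (S \ B') / (2 * u) := by
    have hlt : (S \ B').card < k := by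
      rw [← hSk]
      refine Finset.card_lt_card (Finset.ssubset_iff_of_subset Finset.sdiff_subset |>.2 ?_)
      exact ⟨x, hx, fun h => (Finset.mem_sdiff.1 h).2 (hBB' hxB)⟩
    rcases ih _ hlt (S \ B') rfl hI' with h | h
    · rw [h]; simp [ES, W]
    · linarith
  have hWd : W S / (2 * u) = W B' / (2 * u) + W (S \ B') / (2 * u) := by
    rw [hWS, add_div]
  linarith
end MGraph

/-- Let `Γ` be a connected metric graph of first Betti number `b ≥ 2`
and total length `L`, and let `n ∈ {1,...,b}`. Then there exist at least `n`
homologically independent loops in `Γ` based at the same point, each of length at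
most `24(log b + n) · L / b`. -/
theorem short_homologically_independent_loops_unnormalized (G : MGraph) (b n : ℕ)
    (L : ℝ) (hb : 2 ≤ b) (hn1 : 1 ≤ n) (hnb : n ≤ b)
    (hconn : G.Connected) (hbetti : G.bettiEq b) (hlen : G.totalLength = L) :
    ∃ (x : G.V) (c : Fin n → List (G.E × Bool)),
      (∀ i, G.IsWalk x x (c i)) ∧
      (∀ i, G.walkLen (c i) ≤ 24 * (Real.log b + n) * L / b) ∧
      LinearIndependent ℝ (fun i => G.cycVec (c i)) := by
  classical
  have hcardE : Fintype.card G.E + 1 = Fintype.card G.V + b := by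
    unfold MGraph.bettiEq at hbetti; omega
  have hn' : (1:ℝ) ≤ n := by exact_mod_cast hn1
  have hb' : (2:ℝ) ≤ b := by exact_mod_cast hb
  have hlog : 0 < Real.log b := Real.log_pos (by linarith)
  have hL0 : 0 ≤ L := by
    rw [← hlen]; exact Finset.sum_nonneg fun e _ => G.len_nonneg e
  have hVne : Nonempty G.V := by
    by_contra h
    rw [not_nonempty_iff] at h
    have hE : IsEmpty G.E := ⟨fun e => h.false (G.s e)⟩
    rw [Fintype.card_eq_zero, Fintype.card_eq_zero] at hcardE
    omega
  obtain ⟨x₀⟩ := hVne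
  rcases hL0.eq_or_lt with hL0 | hL0
  · -- all lengths vanish
    have hz : ∀ e, G.len e = 0 := by
      intro e
      refine le_antisymm ?_ (G.len_nonneg e)
      rw [hL0, ← hlen]
      exact Finset.single_le_sum (f := G.len) (fun e _ => G.len_nonneg e) (Finset.mem_univ e)
    choose q hq using hconn x₀
    let p : G.V → List (G.E × Bool) := fun v => if v = x₀ then [] else q v
    have hp : ∀ v, G.IsWalk x₀ v (p v) := by
      intro v
      by_cases h : v = x₀
      · simp [p, h, MGraph.IsWalk]
      · simpa [p, h] using hq v
    obtain ⟨c, -, hc⟩ := MGraph.exists_indep x₀ Finset.univ (Finset.mem_univ _) Finset.univ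
      (by simp) p (by simp [p]) n (by simp only [Finset.card_univ]; omega)
    refine ⟨x₀, fun i => MGraph.eloop p (c i), fun i => MGraph.eloop_isWalk hp _, fun i => ?_, hc⟩
    rw [← hL0]
    simp [MGraph.walkLen, hz]
  -- positive length
  set u := L / b with hu'
  have hu : 0 < u := by positivity
  have hLu : L = b * u := by rw [hu']; field_simp
  by_contra hcon
  have hyp : ∀ x, ∀ S : Finset G.V, x ∈ S → ∀ F : Finset G.E,
      (∀ e ∈ F, G.s e ∈ S ∧ G.t e ∈ S) →
      (∀ e ∈ F, G.vdist x (G.s e) + G.len e + G.vdist x (G.t e) ≤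
        2 * (9 * n * u + 4 * u * Real.log b)) → F.card + 2 ≤ S.card + n := by
    intro x S hx F hF hshort
    by_contra hlt
    apply hcon
    have hnu : 0 < n * u := by positivity
    choose q hq hq' using fun v => MGraph.exists_walk_lt hconn x v hnu
    let p : G.V → List (G.E × Bool) := fun v => if v = x then [] else q v
    have hp : ∀ v, G.IsWalk x v (p v) := by
      intro v
      by_cases h : v = x
      · simp [p, h, MGraph.IsWalk]
      · simpa [p, h] using hq v
    have hp' : ∀ v, G.walkLen (p v) ≤ G.vdist x v + n * u := by
      intro v
      by_cases h : v = x
      · have h1 : p v = [] := by simp [p, h]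
        have h2 := MGraph.walkLen_nonneg (q v)
        have h3 := hq' v
        rw [h1]
        simp only [MGraph.walkLen, List.map_nil, List.sum_nil] at h2 h3 ⊢
        linarith
      · simpa [p, h] using (hq' v).le
    obtain ⟨c, hcF, hc⟩ := MGraph.exists_indep x S hx F hF p (by simp [p]) n (by omega)
    refine ⟨x, fun i => MGraph.eloop p (c i), fun i => MGraph.eloop_isWalk hp _, fun i => ?_, hc⟩
    rw [MGraph.walkLen_eloop]
    have h1 := hp' (G.s (c i))
    have h2 := hp' (G.t (c i))
    have h3 := hshort _ (hcF i)
    have h4 : 24 * (Real.log b + n) * L / b = 24 * (Real.log b * u) + 24 * (n * u) := by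
      rw [hu']; ring
    rw [h4]
    have h5 : 0 < Real.log b * u := by positivity
    nlinarith
  have hcE : (Fintype.card G.E : ℝ) + 1 = Fintype.card G.V + b := by exact_mod_cast hcardE
  by_cases hcase : 2 * n ≤ b
  · have hcase' : 2 * (n:ℝ) ≤ b := by exact_mod_cast hcase
    have hI : MGraph.Inv (4 * n * u) (Finset.univ : Finset G.V) := by
      intro T _ hT hcl
      rw [MGraph.closed_univ hconn hT hcl, MGraph.W_univ, hlen, hLu]
      nlinarith
    rcases MGraph.main_induction hconn hn1 hb hu (by rw [hlen, hLu]) hyp _ Finset.univ rfl hI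
      with h | h
    · exact absurd h (Finset.nonempty_iff_ne_empty.1 ⟨x₀, Finset.mem_univ _⟩)
    · have hES : MGraph.ES (Finset.univ : Finset G.V) = Finset.univ := by ext e; simp [MGraph.ES]
      have hW : 2 * L / (2 * u) = b := by rw [hLu]; field_simp
      rw [hES, MGraph.W_univ, hlen, hW] at h
      simp only [Finset.card_univ] at h
      linarith
  · have hcase' : (b:ℝ) ≤ 2 * n := by exact_mod_cast (not_le.1 hcase).le
    have hd : ∀ v, G.vdist x₀ v ≤ L := by
      intro v
      have hco := MGraph.coarea Finset.univ
        (fun e => G.vdist x₀ (G.s e)) (fun e => G.vdist x₀ (G.t e)) G.len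
        (MGraph.vdist_s hconn x₀) (MGraph.vdist_t hconn x₀) (a := 0) (b := G.vdist x₀ v) (by
          intro σ h1 h2
          have hncl : ¬ MGraph.Closed (Finset.univ.filter fun w => σ ≤ G.vdist x₀ w)
              Finset.univ := by
            intro hcl
            have := MGraph.closed_univ hconn ⟨v, by simpa using h2.le⟩ hcl
            have hx : x₀ ∈ Finset.univ.filter fun w => σ ≤ G.vdist x₀ w := by
              rw [this]; exact Finset.mem_univ _
            have h3 := (Finset.mem_filter.1 hx).2
            have h4 := MGraph.vdist_self_le x₀
            linarith
          by_contra hno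
          push Not at hno
          apply hncl
          intro e
          have h5 := hno e (Finset.mem_univ e)
          simp only [Finset.mem_filter, Finset.mem_univ, true_and]
          constructor
          · intro h6 _
            by_contra h7
            exact absurd (h5.2 (not_le.1 h7).le) (not_lt.2 h6)
          · intro h6 _
            by_contra h7
            exact absurd (h5.1 (not_le.1 h7).le) (not_lt.2 h6))
      have : ∑ e, G.len e = L := hlen
      linarith
    have hLn : L ≤ 2 * (n * u) := by rw [hLu]; nlinarith
    have := hyp x₀ Finset.univ (Finset.mem_univ _) Finset.univ (by simp) (by
      intro e _
      have h1 := hd (G.s e)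
      have h2 := hd (G.t e)
      have h3 : G.len e ≤ L := by
        rw [← hlen]
        exact Finset.single_le_sum (f := G.len) (fun e _ => G.len_nonneg e) (Finset.mem_univ e)
      have h4 : 0 < u * Real.log b := by positivity
      have h5 : 0 < n * u := by positivity
      linarith)
    simp only [Finset.card_univ] at this
    omega
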